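/- For all n ≥ 5 and p ≥ 0, A(C_n ∪ pK_1) > A(P_n ∪ pK_1). -/

import Mathlib

open Finset SimpleGraph

/-- A coloring partition of `G`: a partition of the vertex set into (nonempty)
independent (stable) sets. -/
def IsStablePartition {V : Type*} [Fintype V] [DecidableEq V] (G : SimpleGraph V)
    (P : Finpartition (univ : Finset V)) : Prop :=
  ∀ t ∈ P.parts, ∀ u ∈ t, ∀ v ∈ t, ¬ G.Adj u v

open scoped Classical in
/-- `colB G` : the number of coloring partitions of `G`. -/
noncomputable def colB {V : Type*} [Fintype V] [DecidableEq V] (G : SimpleGraph V) : ℕ :=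
  (univ.filter (IsStablePartition G)).card

open scoped Classical in
/-- `colT G` : the total number of blocks summed over all coloring partitions of `G`. -/
noncomputable def colT {V : Type*} [Fintype V] [DecidableEq V] (G : SimpleGraph V) : ℕ :=
  ∑ P ∈ univ.filter (IsStablePartition G), P.parts.card

/-- `colA G = colT G / colB G` : the average number of blocks. -/
noncomputable def colA {V : Type*} [Fintype V] [DecidableEq V] (G : SimpleGraph V) : ℚ :=
  (colT G : ℚ) / (colB G : ℚ)

/-- The `n`-th Bell number: the number of partitions of an `n`-element set. -/
noncomputable def bell (n : ℕ) : ℕ :=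
  Fintype.card (Finpartition (univ : Finset (Fin n)))

/-- The disjoint union of `G` with `p` isolated vertices (`G ∪ pK₁`). -/
def unionIsolated {V : Type*} (G : SimpleGraph V) (p : ℕ) : SimpleGraph (V ⊕ Fin p) :=
  SimpleGraph.fromRel (fun x y => ∃ a b, x = Sum.inl a ∧ y = Sum.inl b ∧ G.Adj a b)

/-- `Hgraph n r` : the graph obtained from the disjoint union of the cycle `C_n` and the
path `P_r` by adding an edge between one endpoint of the path (vertex `0`) and one vertex
of the cycle (vertex `0`). -/
def Hgraph (n r : ℕ) : SimpleGraph (Fin n ⊕ Fin r) :=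
  SimpleGraph.fromRel (fun x y =>
    (∃ a b, x = Sum.inl a ∧ y = Sum.inl b ∧ (cycleGraph n).Adj a b) ∨
    (∃ a b, x = Sum.inr a ∧ y = Sum.inr b ∧ (pathGraph r).Adj a b) ∨
    (∃ (a : Fin n) (b : Fin r), a.val = 0 ∧ b.val = 0 ∧ x = Sum.inl a ∧ y = Sum.inr b))

namespace Finpartition

variable {V : Type*} [Fintype V] [DecidableEq V]

theorem ext_part {P Q : Finpartition (univ : Finset V)}
    (h : ∀ u v, P.part u = P.part v ↔ Q.part u = Q.part v) : P = Q := by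
  have hpart : ∀ v, P.part v = Q.part v := fun v => by
    ext u
    rw [P.mem_part_iff_part_eq_part (mem_univ u) (mem_univ v),
      Q.mem_part_iff_part_eq_part (mem_univ u) (mem_univ v), h]
  ext t
  constructor
  · intro ht
    obtain ⟨a, ha⟩ := P.nonempty_of_mem_parts ht
    rw [← P.part_eq_of_mem ht ha, hpart]
    exact Q.part_mem.2 (mem_univ a)
  · intro ht
    obtain ⟨a, ha⟩ := Q.nonempty_of_mem_parts ht
    rw [← Q.part_eq_of_mem ht ha, ← hpart]
    exact P.part_mem.2 (mem_univ a)

/-- The block of `P` containing `v`, as an element of the type of blocks. -/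
def block (P : Finpartition (univ : Finset V)) (v : V) : P.parts :=
  ⟨P.part v, P.part_mem.2 (mem_univ v)⟩

theorem block_surjective (P : Finpartition (univ : Finset V)) :
    Function.Surjective P.block := by
  rintro ⟨t, ht⟩
  obtain ⟨a, ha⟩ := P.nonempty_of_mem_parts ht
  exact ⟨a, Subtype.ext (P.part_eq_of_mem ht ha)⟩

theorem block_eq_block_iff (P : Finpartition (univ : Finset V)) {u v : V} :
    P.block u = P.block v ↔ P.part u = P.part v := by
  simp [block]

end Finpartition

section ColoringCount

variable {V : Type*} [Fintype V] [DecidableEq V] (G : SimpleGraph V)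

/-- The coloring that gives the vertices of each block of a coloring partition the color of that
block. -/
def coloringOfStablePartition (α : Type*)
    (x : Σ P : {P : Finpartition (univ : Finset V) // IsStablePartition G P}, (P.1.parts ↪ α)) :
    G.Coloring α :=
  Coloring.mk (fun v => x.2 (x.1.1.block v)) fun {u v} huv h => by
    have h' := (x.1.1.block_eq_block_iff).1 (x.2.injective h)
    have hu : u ∈ x.1.1.part v :=
      (x.1.1.mem_part_iff_part_eq_part (mem_univ u) (mem_univ v)).2 h'
    exact x.1.2 _ (x.1.1.part_mem.2 (mem_univ v)) u hu v (x.1.1.mem_part (mem_univ v)) huv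

theorem coloringOfStablePartition_bijective (α : Type*) :
    Function.Bijective (coloringOfStablePartition G α) := by
  classical
  constructor
  · rintro ⟨⟨P, hP⟩, e⟩ ⟨⟨Q, hQ⟩, f⟩ h
    have happ : ∀ v, e (P.block v) = f (Q.block v) := fun v => DFunLike.congr_fun h v
    obtain rfl : P = Q := Finpartition.ext_part fun u v => by
      rw [← P.block_eq_block_iff, ← Q.block_eq_block_iff, ← e.injective.eq_iff, happ, happ,
        f.injective.eq_iff]
    obtain rfl : e = f := by
      ext t
      obtain ⟨v, rfl⟩ := P.block_surjective t
      exact happ v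
    rfl
  · intro C
    let P : Finpartition (univ : Finset V) := Finpartition.ofSetoid (Setoid.ker C)
    have hP : ∀ u v, P.block u = P.block v ↔ C u = C v := fun u v => by
      rw [P.block_eq_block_iff, ← P.mem_part_iff_part_eq_part (mem_univ u) (mem_univ v),
        Finpartition.mem_part_ofSetoid_iff_rel, eq_comm (a := C u)]
      rfl
    have hstable : IsStablePartition G P := fun t ht u hu v hv huv => by
      refine C.valid huv ((hP u v).1 (P.block_eq_block_iff.2 ?_))
      rw [P.part_eq_of_mem ht hu, P.part_eq_of_mem ht hv]
    have hinv : ∀ t, P.block (Function.surjInv P.block_surjective t) = t :=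
      Function.surjInv_eq P.block_surjective
    refine ⟨⟨⟨P, hstable⟩, ⟨fun t => C (Function.surjInv P.block_surjective t), ?_⟩⟩, ?_⟩
    · intro s t hst
      rw [← hinv s, ← hinv t]
      exact (hP _ _).2 hst
    · ext v
      exact (hP _ _).1 (hinv _)

open scoped Classical in
theorem card_coloring_eq_sum_descFactorial (k : ℕ) :
    Nat.card (G.Coloring (Fin k)) =
      ∑ P ∈ univ.filter (IsStablePartition G), k.descFactorial P.parts.card := by
  rw [← Nat.card_congr (Equiv.ofBijective _ (coloringOfStablePartition_bijective G (Fin k))),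
    Nat.card_sigma, ← Finset.sum_subtype_eq_sum_filter]
  simp only [Nat.card_eq_fintype_card, Fintype.card_embedding_eq, Fintype.card_fin,
    Fintype.card_coe]
  rw [Finset.subtype_univ]

theorem hasSum_descFactorial_div_factorial (r : ℕ) :
    HasSum (fun k : ℕ => (k.descFactorial r : ℝ) / k.factorial) (Real.exp 1) := by
  have h := NormedSpace.expSeries_div_hasSum_exp (1 : ℝ)
  rw [← Real.exp_eq_exp_ℝ] at h
  have hz : ∑ i ∈ range r, (i.descFactorial r : ℝ) / i.factorial = 0 :=
    Finset.sum_eq_zero fun i hi => by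
      simp [Nat.descFactorial_eq_zero_iff_lt.2 (Finset.mem_range.1 hi)]
  rw [← add_zero (Real.exp 1), ← hz, ← hasSum_nat_add_iff r]
  have heq : (fun k : ℕ => ((k + r).descFactorial r : ℝ) / (k + r).factorial) =
      fun k : ℕ => (1 : ℝ) ^ k / k.factorial := by
    ext k
    have hk : (k.factorial : ℝ) * ((k + r).descFactorial r : ℝ) = (k + r).factorial := by
      have := Nat.factorial_mul_descFactorial (Nat.le_add_left r k)
      rw [Nat.add_sub_cancel] at this
      exact_mod_cast this
    have h1 : (k.factorial : ℝ) ≠ 0 := by positivity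
    have h2 : ((k + r).factorial : ℝ) ≠ 0 := by positivity
    rw [one_pow, div_eq_div_iff h2 h1, one_mul, mul_comm, hk]
  rw [heq]
  exact h

theorem hasSum_mul_descFactorial_div_factorial (r : ℕ) :
    HasSum (fun k : ℕ => (k : ℝ) * ((k.descFactorial r : ℝ) / k.factorial))
      ((r + 1) * Real.exp 1) := by
  have h := (hasSum_descFactorial_div_factorial (r + 1)).add
    ((hasSum_descFactorial_div_factorial r).mul_left (r : ℝ))
  convert h using 1
  · ext k
    rcases le_or_gt r k with hk | hk
    · rw [Nat.descFactorial_succ]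
      push_cast [hk]
      ring
    · simp [Nat.descFactorial_of_lt hk]
  · ring

/-- Dobinski's formula for coloring partitions. -/
theorem hasSum_card_coloring_div_factorial :
    HasSum (fun k : ℕ => (Nat.card (G.Coloring (Fin k)) : ℝ) / k.factorial)
      (colB G * Real.exp 1) := by
  classical
  have h := hasSum_sum (s := univ.filter (IsStablePartition G))
    fun P _ => hasSum_descFactorial_div_factorial P.parts.card
  convert h using 1
  · ext k
    rw [card_coloring_eq_sum_descFactorial, Nat.cast_sum, Finset.sum_div]
  · rw [Finset.sum_const, nsmul_eq_mul, colB]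

theorem hasSum_mul_card_coloring_div_factorial :
    HasSum (fun k : ℕ => (k : ℝ) * ((Nat.card (G.Coloring (Fin k)) : ℝ) / k.factorial))
      ((colT G + colB G) * Real.exp 1) := by
  classical
  have h := hasSum_sum (s := univ.filter (IsStablePartition G))
    fun P _ => hasSum_mul_descFactorial_div_factorial P.parts.card
  convert h using 1
  · ext k
    rw [card_coloring_eq_sum_descFactorial, Nat.cast_sum, Finset.sum_div, Finset.mul_sum]
  · rw [← Finset.sum_mul, Finset.sum_add_distrib, Finset.sum_const, nsmul_one, colT, colB]
    push_cast
    congr!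

end ColoringCount

section WalkCount

/-- The proper colorings with `k` colors of a path on `n + 1` vertices. -/
abbrev PathColoring (n k : ℕ) : Type :=
  {f : Fin (n + 1) → Fin k // ∀ i : Fin n, f i.castSucc ≠ f i.succ}

namespace PathColoring

variable {n k : ℕ}

/-- Remove the last vertex. -/
def init (f : PathColoring (n + 1) k) : PathColoring n k :=
  ⟨Fin.init f.1, fun i => f.2 i.castSucc⟩

/-- Append a vertex with a color other than that of the last one. -/
def snoc (g : PathColoring n k) (c : Fin k) (hc : c ≠ g.1 (Fin.last n)) :
    PathColoring (n + 1) k :=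
  ⟨Fin.snoc g.1 c, fun i => by
    refine Fin.lastCases ?_ (fun j => ?_) i
    · rw [Fin.succ_last, Fin.snoc_last, Fin.snoc_castSucc]
      exact hc.symm
    · rw [← Fin.castSucc_succ, Fin.snoc_castSucc, Fin.snoc_castSucc]
      exact g.2 j⟩

theorem init_snoc (g : PathColoring n k) (c : Fin k) (hc : c ≠ g.1 (Fin.last n)) :
    (g.snoc c hc).init = g :=
  Subtype.ext (Fin.init_snoc (α := fun _ => Fin k) c g.1)

theorem last_ne_init_last (f : PathColoring (n + 1) k) :
    f.1 (Fin.last (n + 1)) ≠ f.init.1 (Fin.last n) :=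
  (f.2 (Fin.last n)).symm

theorem snoc_init (f : PathColoring (n + 1) k) :
    f.init.snoc (f.1 (Fin.last (n + 1))) f.last_ne_init_last = f :=
  Subtype.ext (Fin.snoc_init_self f.1)

/-- A path coloring is determined by its restriction to all vertices but the last, and the color
of the last. -/
def snocEquiv (n k : ℕ) :
    PathColoring (n + 1) k ≃ Σ g : PathColoring n k, {c : Fin k // c ≠ g.1 (Fin.last n)} where
  toFun f := ⟨f.init, f.1 (Fin.last (n + 1)), f.last_ne_init_last⟩
  invFun x := x.1.snoc x.2.1 x.2.2
  left_inv f := f.snoc_init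
  right_inv x := by
    obtain ⟨g, c, hc⟩ := x
    have h1 : (g.snoc c hc).1 (Fin.last (n + 1)) = c := Fin.snoc_last (α := fun _ => Fin k) c g.1
    have h2 := g.init_snoc c hc
    refine Sigma.ext h2 ?_
    refine (Subtype.heq_iff_coe_eq fun x => ?_).2 h1
    exact iff_of_eq (congrArg (fun f : PathColoring n k => x ≠ f.1 (Fin.last n)) h2)

/-- Path colorings with equal end colors arise from those with distinct end colors by appending a
vertex with the color of the first one. -/
def closedEquiv (n k : ℕ) :
    {f : PathColoring (n + 1) k // f.1 0 = f.1 (Fin.last (n + 1))} ≃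
      {g : PathColoring n k // g.1 0 ≠ g.1 (Fin.last n)} where
  toFun f := ⟨f.1.init, fun h => f.1.last_ne_init_last (f.2.symm.trans h)⟩
  invFun g := ⟨g.1.snoc (g.1.1 0) g.2, by
    have h1 : (g.1.snoc (g.1.1 0) g.2).1 (Fin.last (n + 1)) = g.1.1 0 :=
      Fin.snoc_last (α := fun _ => Fin k) (g.1.1 0) g.1.1
    have h2 : (g.1.snoc (g.1.1 0) g.2).1 (Fin.castSucc 0) = g.1.1 0 :=
      Fin.snoc_castSucc (α := fun _ => Fin k) (g.1.1 0) g.1.1 0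
    rw [h1]
    exact h2⟩
  left_inv f := by
    refine Subtype.ext ?_
    conv_rhs => rw [← f.1.snoc_init]
    exact Subtype.ext (congrArg (Fin.snoc (α := fun _ => Fin k) f.1.init.1) f.2)
  right_inv g := Subtype.ext (init_snoc _ _ g.2)

theorem natCard_eq (n k : ℕ) :
    (Nat.card (PathColoring n k) : ℝ) = k * ((k : ℝ) - 1) ^ n := by
  induction n with
  | zero =>
    have : PathColoring 0 k ≃ (Fin 1 → Fin k) := Equiv.subtypeUnivEquiv fun f i => i.elim0
    rw [Nat.card_congr this]
    simp
  | succ n ih =>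
    have := Fintype.ofFinite (PathColoring n k)
    rw [Nat.card_congr (snocEquiv n k), Nat.card_sigma]
    have hc : ∀ g : PathColoring n k,
        (Nat.card {c : Fin k // c ≠ g.1 (Fin.last n)} : ℝ) = (k : ℝ) - 1 := fun g => by
      have hk : 1 ≤ k := Fin.pos (g.1 0)
      rw [Nat.card_eq_fintype_card, Fintype.card_subtype_compl]
      simp [hk]
    rw [Nat.cast_sum, Finset.sum_congr rfl fun g _ => hc g, Finset.sum_const, nsmul_eq_mul,
      Finset.card_univ, ← Nat.card_eq_fintype_card, ih]
    ring

theorem natCard_open_eq (n k : ℕ) :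
    (Nat.card {g : PathColoring n k // g.1 0 ≠ g.1 (Fin.last n)} : ℝ) =
      ((k : ℝ) - 1) ^ (n + 1) + (-1) ^ (n + 1) * ((k : ℝ) - 1) := by
  induction n with
  | zero => simp
  | succ n ih =>
    classical
    have h := Nat.card_congr
      (Equiv.sumCompl fun g : PathColoring (n + 1) k => g.1 0 = g.1 (Fin.last (n + 1)))
    rw [Nat.card_sum, Nat.card_congr (closedEquiv n k)] at h
    have h' : (Nat.card {g : PathColoring n k // g.1 0 ≠ g.1 (Fin.last n)} : ℝ) +
        Nat.card {g : PathColoring (n + 1) k // g.1 0 ≠ g.1 (Fin.last (n + 1))} =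
        k * ((k : ℝ) - 1) ^ (n + 1) := by
      rw [← natCard_eq]
      exact_mod_cast h
    rw [ih] at h'
    linear_combination h'

end PathColoring

/-- Colorings are the functions that separate adjacent vertices. -/
def coloringEquivSubtype {V : Type*} (G : SimpleGraph V) (α : Type*) :
    G.Coloring α ≃ {f : V → α // ∀ u v, G.Adj u v → f u ≠ f v} where
  toFun C := ⟨C, fun _ _ h => C.valid h⟩
  invFun f := Coloring.mk f.1 fun {u v} h => f.2 u v h
  left_inv _ := rfl
  right_inv _ := rfl

theorem pathGraph_proper_iff {n k : ℕ} (f : Fin (n + 1) → Fin k) :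
    (∀ u v, (pathGraph (n + 1)).Adj u v → f u ≠ f v) ↔
      ∀ i : Fin n, f i.castSucc ≠ f i.succ := by
  constructor
  · intro h i
    exact h _ _ (pathGraph_adj.2 (Or.inl (by simp)))
  · intro h
    have hlt : ∀ u v : Fin (n + 1), u.val + 1 = v.val → f u ≠ f v := fun u v huv => by
      have hu : u.val < n := by omega
      have h1 : u = (⟨u.val, hu⟩ : Fin n).castSucc := rfl
      have h2 : v = (⟨u.val, hu⟩ : Fin n).succ := Fin.ext huv.symm
      rw [h1, h2]
      exact h _
    intro u v huv
    rcases pathGraph_adj.1 huv with h | h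
    · exact hlt u v h
    · exact (hlt v u h).symm

theorem cycleGraph_adj_iff {n : ℕ} (hn : 1 ≤ n) {u v : Fin (n + 1)} :
    (cycleGraph (n + 1)).Adj u v ↔ (pathGraph (n + 1)).Adj u v ∨
      (u = 0 ∧ v = Fin.last n) ∨ (v = 0 ∧ u = Fin.last n) := by
  rw [cycleGraph_adj', pathGraph_adj]
  simp only [Fin.ext_iff, Fin.val_zero, Fin.val_last, Fin.val_sub]
  have hu := u.2
  have hv := v.2
  generalize u.val = a at *
  generalize v.val = b at *
  have key : ∀ a b : ℕ, a < n + 1 → b < n + 1 →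
      ((n + 1 - b + a) % (n + 1) = 1 ↔ b + 1 = a ∨ (a = 0 ∧ b = n)) := fun a b ha hb => by
    rcases le_or_gt b a with h | h
    · rw [show n + 1 - b + a = (a - b) + (n + 1) by omega, Nat.add_mod_right,
        Nat.mod_eq_of_lt (by omega)]
      omega
    · rw [Nat.mod_eq_of_lt (by omega)]
      omega
  rw [key a b hu hv, key b a hv hu]
  tauto

theorem natCard_coloring_pathGraph (n k : ℕ) :
    (Nat.card ((pathGraph (n + 1)).Coloring (Fin k)) : ℝ) = k * ((k : ℝ) - 1) ^ n := by
  rw [← PathColoring.natCard_eq]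
  exact congrArg _ (Nat.card_congr ((coloringEquivSubtype _ _).trans
    (Equiv.subtypeEquivRight pathGraph_proper_iff)))

theorem natCard_coloring_cycleGraph {n : ℕ} (hn : 1 ≤ n) (k : ℕ) :
    (Nat.card ((cycleGraph (n + 1)).Coloring (Fin k)) : ℝ) =
      ((k : ℝ) - 1) ^ (n + 1) + (-1) ^ (n + 1) * ((k : ℝ) - 1) := by
  rw [← PathColoring.natCard_open_eq]
  refine congrArg _ (Nat.card_congr ((coloringEquivSubtype _ _).trans
    ((Equiv.subtypeEquivRight fun f => ?_).trans
      (Equiv.subtypeSubtypeEquivSubtypeInter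
        (fun f : Fin (n + 1) → Fin k => ∀ i : Fin n, f i.castSucc ≠ f i.succ)
        fun f => f 0 ≠ f (Fin.last n)).symm)))
  simp only [cycleGraph_adj_iff hn, ← pathGraph_proper_iff]
  constructor
  · exact fun h => ⟨fun u v huv => h u v (Or.inl huv), h _ _ (Or.inr (Or.inl ⟨rfl, rfl⟩))⟩
  · rintro ⟨h1, h2⟩ u v (huv | ⟨rfl, rfl⟩ | ⟨rfl, rfl⟩)
    · exact h1 u v huv
    · exact h2
    · exact h2.symm

/-- Isolated vertices are colored freely. -/
def coloringUnionIsolatedEquiv {V : Type*} (G : SimpleGraph V) (p : ℕ) (α : Type*) :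
    (unionIsolated G p).Coloring α ≃ G.Coloring α × (Fin p → α) where
  toFun C := ⟨Coloring.mk (fun v => C (Sum.inl v)) fun {u v} h => C.valid (by
    simp [unionIsolated, h, h.ne]), fun i => C (Sum.inr i)⟩
  invFun x := Coloring.mk (Sum.elim x.1 x.2) fun {u v} h => by
    simp only [unionIsolated, fromRel_adj] at h
    obtain ⟨-, ⟨a, b, rfl, rfl, h⟩ | ⟨a, b, rfl, rfl, h⟩⟩ := h
    · exact x.1.valid h
    · exact (x.1.valid h).symm
  left_inv C := by
    ext v
    cases v <;> rfl
  right_inv _ := rfl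

theorem natCard_coloring_unionIsolated {V : Type*} (G : SimpleGraph V) (p k : ℕ) :
    Nat.card ((unionIsolated G p).Coloring (Fin k)) = Nat.card (G.Coloring (Fin k)) * k ^ p := by
  rw [Nat.card_congr (coloringUnionIsolatedEquiv G p (Fin k)), Nat.card_prod]
  simp

end WalkCount

section Cross

theorem cross_sum_succ (c q : ℕ → ℝ) (N : ℕ) :
    (∑ k ∈ range (N + 1), (k : ℝ) * c k) * ∑ k ∈ range (N + 1), q k -
        (∑ k ∈ range (N + 1), (k : ℝ) * q k) * ∑ k ∈ range (N + 1), c k =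
      (∑ k ∈ range N, (k : ℝ) * c k) * ∑ k ∈ range N, q k -
        (∑ k ∈ range N, (k : ℝ) * q k) * ∑ k ∈ range N, c k +
      ∑ j ∈ range N, ((N : ℝ) - j) * (c N * q j - q N * c j) := by
  have h : ∑ j ∈ range N, ((N : ℝ) - j) * (c N * q j - q N * c j) =
      N * c N * ∑ j ∈ range N, q j - N * q N * ∑ j ∈ range N, c j -
        c N * ∑ j ∈ range N, (j : ℝ) * q j + q N * ∑ j ∈ range N, (j : ℝ) * c j := by
    simp only [Finset.mul_sum, ← Finset.sum_sub_distrib, ← Finset.sum_add_distrib]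
    exact Finset.sum_congr rfl fun j _ => by ring
  simp only [Finset.sum_range_succ]
  rw [h]
  ring

/-- A comparison of means `∑ k * c k / ∑ c k` and `∑ k * q k / ∑ q k`, where `c / q` is monotone on
`{3, 4, …}` and the pairs of indices involving `2` are compensated by those involving `3`. -/
theorem mul_lt_mul_of_hasSum {c q : ℕ → ℝ} {C Q C₁ Q₁ : ℝ}
    (hC : HasSum c C) (hQ : HasSum q Q) (hC₁ : HasSum (fun k : ℕ => (k : ℝ) * c k) C₁)
    (hQ₁ : HasSum (fun k : ℕ => (k : ℝ) * q k) Q₁)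
    (hc0 : c 0 = 0) (hc1 : c 1 = 0) (hq0 : q 0 = 0) (hq1 : q 1 = 0)
    (hmono : ∀ j k : ℕ, 3 ≤ j → j < k → 0 ≤ c k * q j - q k * c j)
    (hcomp : ∀ k : ℕ, 4 ≤ k →
      0 ≤ ((k : ℝ) - 2) * (c k * q 2 - q k * c 2) + ((k : ℝ) - 3) * (c k * q 3 - q k * c 3))
    (hpos : 0 < (c 3 * q 2 - q 3 * c 2) + 2 * (c 4 * q 2 - q 4 * c 2) +
      (c 4 * q 3 - q 4 * c 3)) :
    Q₁ * C < C₁ * Q := by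
  set S : ℕ → ℝ := fun N => (∑ k ∈ range N, (k : ℝ) * c k) * ∑ k ∈ range N, q k -
        (∑ k ∈ range N, (k : ℝ) * q k) * ∑ k ∈ range N, c k with hS
  have hlim : Filter.Tendsto S Filter.atTop (nhds (C₁ * Q - Q₁ * C)) :=
    (hC₁.tendsto_sum_nat.mul hQ.tendsto_sum_nat).sub
      (hQ₁.tendsto_sum_nat.mul hC.tendsto_sum_nat)
  have hstep : ∀ N, 5 ≤ N → S N ≤ S (N + 1) := fun N hN => by
    simp only [hS]
    rw [cross_sum_succ, le_add_iff_nonneg_right,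
      ← Finset.sum_range_add_sum_Ico _ (show 4 ≤ N by omega)]
    refine add_nonneg ?_ (Finset.sum_nonneg fun j hj => ?_)
    · have := hcomp N (by omega)
      simp only [Finset.sum_range_succ, Finset.sum_range_zero, hc0, hc1, hq0, hq1]
      push_cast
      linarith
    · rw [Finset.mem_Ico] at hj
      have hjN : (j : ℝ) ≤ N := by exact_mod_cast hj.2.le
      exact mul_nonneg (by linarith) (hmono j N (by omega) hj.2)
  have hS5 : 0 < S 5 := by
    simp only [hS, Finset.sum_range_succ, Finset.sum_range_zero, hc0, hc1, hq0, hq1]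
    push_cast
    linarith
  have hge : ∀ N, 5 ≤ N → S 5 ≤ S N := fun N hN => by
    induction N, hN using Nat.le_induction with
    | base => exact le_rfl
    | succ N hN ih => exact ih.trans (hstep N hN)
  have := ge_of_tendsto hlim (Filter.eventually_atTop.2 ⟨5, hge⟩)
  linarith

end Cross

section Weights

theorem add_one_mul_pow_sub_le {a b : ℝ} {M : ℕ} (hM : 4 ≤ M) (hb : 2 ≤ b) (hab : b + 1 ≤ a) :
    (a + 1) * a ^ M - (b + 1) * b ^ M ≤ a ^ M * b ^ M * (a - b) := by
  have hbM : 8 * b ≤ b ^ M := by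
    have h1 : b ^ 4 ≤ b ^ M := pow_le_pow_right₀ (by linarith) hM
    have h2 : (2 : ℝ) ^ 3 ≤ b ^ 3 := pow_le_pow_left₀ (by norm_num) hb 3
    nlinarith
  have ha : 0 ≤ a ^ M := pow_nonneg (by linarith) M
  have h : a + 1 ≤ b ^ M * (a - b) := by
    have h1 : 8 * b * (a - b) ≤ b ^ M * (a - b) :=
      mul_le_mul_of_nonneg_right hbM (by linarith)
    nlinarith
  have h3 : (a + 1) * a ^ M ≤ b ^ M * (a - b) * a ^ M := mul_le_mul_of_nonneg_right h ha
  have h4 : 0 ≤ (b + 1) * b ^ M := mul_nonneg (by linarith) (pow_nonneg (by linarith) M)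
  nlinarith

theorem compensation_nonneg {a v w : ℝ} {M : ℕ} (hM : 4 ≤ M) (ha : 3 ≤ a) (hw : 0 ≤ w)
    (hvw : v ≤ 3 / 2 * w) :
    0 ≤ (a - 1) * (v * (a ^ M * (a - 1) + (2 - (a + 1) * a ^ M))) +
      (a - 2) * (w * (a ^ M * 2 ^ M * (a - 2) + (3 * 2 ^ M - (a + 1) * a ^ M))) := by
  have hy : (16 : ℝ) ≤ 2 ^ M := by
    have : (2 : ℝ) ^ 4 ≤ 2 ^ M := pow_le_pow_right₀ (by norm_num) hM
    linarith
  have hx : (1 : ℝ) ≤ a ^ M := one_le_pow₀ (by linarith)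
  generalize (2 : ℝ) ^ M = y at *
  generalize a ^ M = x at *
  have h1 : (15 * a - 33) * x ≤ x * y * (a - 2) + (3 * y - (a + 1) * x) := by
    have : x * (a - 2) * 16 ≤ x * (a - 2) * y :=
      mul_le_mul_of_nonneg_left hy (mul_nonneg (by linarith) (by linarith))
    nlinarith
  have h2 : (a - 1) * (x - 1) * (2 * v) ≤ (a - 1) * (x - 1) * (3 * w) :=
    mul_le_mul_of_nonneg_left (by linarith) (mul_nonneg (by linarith) (by linarith))
  have h3 : (a - 2) * w * ((15 * a - 33) * x) ≤
      (a - 2) * w * (x * y * (a - 2) + (3 * y - (a + 1) * x)) :=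
    mul_le_mul_of_nonneg_left h1 (mul_nonneg (by linarith) hw)
  have h4 : 0 ≤ w * ((a - 2) * ((15 * a - 33) * x) - 3 * (a - 1) * (x - 1)) := by
    refine mul_nonneg hw ?_
    have : 0 ≤ ((a - 2) * (15 * a - 33) - 3 * (a - 1)) * x :=
      mul_nonneg (by nlinarith) (by linarith)
    nlinarith
  nlinarith

theorem initial_cross_pos {M : ℕ} (hM : 4 ≤ M) {w₂ w₃ w₄ : ℝ} (h₃ : 0 < w₃) (h₄ : 0 < w₄)
    (h₂₃ : w₂ ≤ 3 / 2 * w₃) (h₂₄ : w₂ ≤ 4 * w₄) :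
    0 < w₃ * w₂ * (2 ^ M + (2 - 3 * 2 ^ M)) + 2 * (w₄ * w₂ * (3 ^ M * 2 + (2 - 4 * 3 ^ M))) +
      w₄ * w₃ * (3 ^ M * 2 ^ M + (3 * 2 ^ M - 4 * 3 ^ M)) := by
  have hy : (16 : ℝ) ≤ 2 ^ M := by
    have : (2 : ℝ) ^ 4 ≤ 2 ^ M := pow_le_pow_right₀ (by norm_num) hM
    linarith
  have hxy : (2 : ℝ) ^ M ≤ 3 ^ M := pow_le_pow_left₀ (by norm_num) (by norm_num) M
  generalize (2 : ℝ) ^ M = y at *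
  generalize (3 : ℝ) ^ M = x at *
  have h1 : w₃ * (2 * y - 2) * w₂ ≤ w₃ * (2 * y - 2) * (4 * w₄) :=
    mul_le_mul_of_nonneg_left h₂₄ (mul_nonneg h₃.le (by linarith))
  have h2 : w₄ * (4 * x - 4) * w₂ ≤ w₄ * (4 * x - 4) * (3 / 2 * w₃) :=
    mul_le_mul_of_nonneg_left h₂₃ (mul_nonneg h₄.le (by linarith))
  have h3 : 0 < w₄ * w₃ * (x * y - 10 * x - 5 * y + 14) :=
    mul_pos (mul_pos h₄ h₃) (by nlinarith)
  nlinarith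

/-- The weight `k ^ p * (k - 1) / k!`. -/
noncomputable def colWeight (p k : ℕ) : ℝ := (k : ℝ) ^ p * ((k : ℝ) - 1) / k.factorial

theorem colWeight_pos {p k : ℕ} (hk : 2 ≤ k) : 0 < colWeight p k := by
  have h : (2 : ℝ) ≤ k := by exact_mod_cast hk
  have : (0 : ℝ) < (k : ℝ) - 1 := by linarith
  unfold colWeight
  positivity

theorem colWeight_two_le_three (p : ℕ) : colWeight p 2 ≤ 3 / 2 * colWeight p 3 := by
  have : (2 : ℝ) ^ p ≤ 3 ^ p := pow_le_pow_left₀ (by norm_num) (by norm_num) p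
  norm_num [colWeight, Nat.factorial]
  linarith

theorem colWeight_two_le_four (p : ℕ) : colWeight p 2 ≤ 4 * colWeight p 4 := by
  have : (2 : ℝ) ^ p ≤ 4 ^ p := pow_le_pow_left₀ (by norm_num) (by norm_num) p
  norm_num [colWeight, Nat.factorial]
  linarith

theorem card_cycle_div_factorial {M : ℕ} (p k : ℕ) :
    (Nat.card ((unionIsolated (cycleGraph (M + 2)) p).Coloring (Fin k)) : ℝ) / k.factorial =
      colWeight p k * (((k : ℝ) - 1) ^ (M + 1) + (-1) ^ M) := by
  rw [natCard_coloring_unionIsolated, Nat.cast_mul,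
    natCard_coloring_cycleGraph (Nat.le_add_left 1 M), colWeight]
  push_cast
  ring

theorem card_path_div_factorial {M : ℕ} (p k : ℕ) :
    (Nat.card ((unionIsolated (pathGraph (M + 2)) p).Coloring (Fin k)) : ℝ) / k.factorial =
      colWeight p k * (k * ((k : ℝ) - 1) ^ M) := by
  rw [natCard_coloring_unionIsolated, Nat.cast_mul, natCard_coloring_pathGraph, colWeight]
  push_cast
  ring

theorem weighted_cross_eq (v w s a b : ℝ) (M : ℕ) :
    v * ((a - 1) ^ (M + 1) + s) * (w * (b * (b - 1) ^ M)) -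
        v * (a * (a - 1) ^ M) * (w * ((b - 1) ^ (M + 1) + s)) =
      v * w * ((a - 1) ^ M * (b - 1) ^ M * (a - b) + s * (b * (b - 1) ^ M - a * (a - 1) ^ M)) := by
  ring

theorem cross_pos_of_neg {a b : ℝ} (M : ℕ) (hb : 2 ≤ b) (hab : b < a) :
    0 < (a - 1) ^ M * (b - 1) ^ M * (a - b) + -1 * (b * (b - 1) ^ M - a * (a - 1) ^ M) := by
  have h1 : (b - 1) ^ M ≤ (a - 1) ^ M := pow_le_pow_left₀ (by linarith) (by linarith) M
  have h2 : 0 < (b - 1) ^ M := pow_pos (by linarith) M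
  have h3 : 0 < (a - 1) ^ M := pow_pos (by linarith) M
  have h4 : 0 < (a - 1) ^ M * (b - 1) ^ M * (a - b) :=
    mul_pos (mul_pos h3 h2) (by linarith)
  nlinarith

end Weights

theorem colB_pos {V : Type*} [Fintype V] [DecidableEq V] (G : SimpleGraph V) : 0 < colB G := by
  classical
  refine Finset.card_pos.2 ⟨⊥, Finset.mem_filter.2 ⟨mem_univ _, ?_⟩⟩
  intro t ht u hu v hv huv
  obtain ⟨a, -, rfl⟩ := Finpartition.mem_bot_iff.1 ht
  rw [Finset.mem_singleton.1 hu, Finset.mem_singleton.1 hv] at huv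
  exact huv.ne rfl

/-- For all `n ≥ 5` and `p ≥ 0`, `A(C_n ∪ pK₁) > A(P_n ∪ pK₁)`. -/
theorem stmt_16 (n p : ℕ) (hn : 5 ≤ n) :
    colA (unionIsolated (cycleGraph n) p) > colA (unionIsolated (pathGraph n) p) := by
  obtain ⟨M, rfl⟩ : ∃ M, n = M + 2 := ⟨n - 2, by omega⟩
  have hBC := colB_pos (unionIsolated (cycleGraph (M + 2)) p)
  have hBP := colB_pos (unionIsolated (pathGraph (M + 2)) p)
  have hC := hasSum_card_coloring_div_factorial (unionIsolated (cycleGraph (M + 2)) p)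
  have hQ := hasSum_card_coloring_div_factorial (unionIsolated (pathGraph (M + 2)) p)
  have hC₁ := hasSum_mul_card_coloring_div_factorial (unionIsolated (cycleGraph (M + 2)) p)
  have hQ₁ := hasSum_mul_card_coloring_div_factorial (unionIsolated (pathGraph (M + 2)) p)
  simp only [card_cycle_div_factorial, card_path_div_factorial] at hC hQ hC₁ hQ₁
  have key := mul_lt_mul_of_hasSum hC hQ hC₁ hQ₁
    (by rcases Nat.even_or_odd M with h | h <;> simp [h.neg_one_pow, h.add_one.neg_one_pow])
    (by simp [colWeight]) (by simp) (by simp [colWeight])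
  simp only [weighted_cross_eq] at key
  have hlt := key ?_ ?_ ?_
  · rw [gt_iff_lt, colA, colA, div_lt_div_iff₀ (by exact_mod_cast hBP) (by exact_mod_cast hBC)]
    have he := Real.exp_pos 1
    generalize colT (unionIsolated (cycleGraph (M + 2)) p) = T₁ at *
    generalize colB (unionIsolated (cycleGraph (M + 2)) p) = B₁ at *
    generalize colT (unionIsolated (pathGraph (M + 2)) p) = T₂ at *
    generalize colB (unionIsolated (pathGraph (M + 2)) p) = B₂ at *
    have h : Real.exp 1 ^ 2 * ((T₂ : ℝ) * B₁) < Real.exp 1 ^ 2 * ((T₁ : ℝ) * B₂) := by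
      linarith
    have h' := lt_of_mul_lt_mul_left h (sq_nonneg _)
    exact_mod_cast h'
  all_goals
    have hw : ∀ k, 2 ≤ k → 0 < colWeight p k := fun k hk => colWeight_pos hk
    have hodd : ∀ j k : ℕ, 2 ≤ j → j < k → 0 < colWeight p k * colWeight p j *
        (((k : ℝ) - 1) ^ M * ((j : ℝ) - 1) ^ M * ((k : ℝ) - j) +
          -1 * (j * ((j : ℝ) - 1) ^ M - k * ((k : ℝ) - 1) ^ M)) := fun j k hj hjk =>
      mul_pos (mul_pos (hw k (by omega)) (hw j hj))
        (cross_pos_of_neg M (by exact_mod_cast hj) (by exact_mod_cast hjk))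
    rcases Nat.even_or_odd M with hM | hM <;> rw [hM.neg_one_pow]
  · intro j k hj hjk
    have hM4 : 4 ≤ M := by obtain ⟨m, rfl⟩ := hM; omega
    refine mul_nonneg (mul_nonneg (hw k (by omega)).le (hw j (by omega)).le) ?_
    have hj' : (3 : ℝ) ≤ j := by exact_mod_cast hj
    have hjk' : (j : ℝ) + 1 ≤ k := by exact_mod_cast hjk
    have h := add_one_mul_pow_sub_le hM4 (a := (k : ℝ) - 1) (b := (j : ℝ) - 1)
      (by linarith) (by linarith)
    simp only [sub_add_cancel, sub_sub_sub_cancel_right] at h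
    linarith
  · exact fun j k hj hjk => (hodd j k (by omega) hjk).le
  · intro k hk
    have hM4 : 4 ≤ M := by obtain ⟨m, rfl⟩ := hM; omega
    have hk' : (4 : ℝ) ≤ k := by exact_mod_cast hk
    have h := mul_nonneg (hw k (by omega)).le (compensation_nonneg hM4 (a := (k : ℝ) - 1)
      (by linarith) (hw 3 (by norm_num)).le (colWeight_two_le_three p))
    norm_num [sub_sub] at h ⊢
    linarith
  · intro k hk
    have hk' : (4 : ℝ) ≤ k := by exact_mod_cast hk
    exact add_nonneg
      (mul_nonneg (by linarith) (by exact_mod_cast (hodd 2 k le_rfl (by omega)).le))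
      (mul_nonneg (by linarith) (by exact_mod_cast (hodd 3 k (by norm_num) (by omega)).le))
  · have hM4 : 4 ≤ M := by obtain ⟨m, rfl⟩ := hM; omega
    have h := initial_cross_pos hM4 (hw 3 (by norm_num)) (hw 4 (by norm_num))
      (colWeight_two_le_three p) (colWeight_two_le_four p)
    norm_num at h ⊢
    linarith
  · have h₁ := hodd 2 3 le_rfl (by norm_num)
    have h₂ := hodd 2 4 le_rfl (by norm_num)
    have h₃ := hodd 3 4 (by norm_num) (by norm_num)
    linarith
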